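/- arXiv:0803.3572 — 2 statements merged into one kernel-verified Lean document; each statement's English description precedes it below -/
import Mathlib

section
/- Let f be any function from the positive integers to the positive integers satisfying the admissibility property: for all integers n ≥ 2 and t ≥ 1 and all positive integers t_1, …, t_n, where in the case n = 2 one additionally assumes t_1 ≥ 2 and t_2 ≥ 2, if t_1 + ⋯ + t_n ≤ t + 1 then f(t_1) + ⋯ + f(t_n) ≤ f(t). Then f(t) ≥ t̄ for every positive integer t, where 1̄ = 1 and t̄ = 3(t−1) for t ≥ 2. In other words, the filtration function t ↦ t̄ is the pointwise smallest admissible filtration function. -/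
/-- The filtration function of Section 4: `1̄ = 1` and `t̄ = 3(t-1)` for `t ≥ 2`. -/
def filtrationFunction (t : ℕ) : ℕ := if t = 1 then 1 else 3 * (t - 1)

/-- Optimality of the filtration function: any admissible function `f` from the positive
integers to the positive integers satisfies `f(t) ≥ t̄` for every positive integer `t`. -/
theorem filtrationFunction_optimal
    (f : ℕ → ℕ) (hfpos : ∀ t, 1 ≤ t → 1 ≤ f t)
    (hadm : ∀ (n t : ℕ), 2 ≤ n → 1 ≤ t → ∀ ts : Fin n → ℕ, (∀ i, 1 ≤ ts i) →
      (n = 2 → ∀ i, 2 ≤ ts i) → ∑ i, ts i ≤ t + 1 → ∑ i, f (ts i) ≤ f t) :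
    ∀ t, 1 ≤ t → filtrationFunction t ≤ f t := by
  have two : 3 ≤ f 2 := by
    have h := hadm 3 2 (by norm_num) (by norm_num) ![1, 1, 1]
      (by simp [Fin.forall_fin_succ]) (by norm_num) (by simp [Fin.sum_univ_succ])
    have h1 := hfpos 1 le_rfl
    simp [Fin.sum_univ_succ] at h
    omega
  have step : ∀ t, 2 ≤ t → f t + f 2 ≤ f (t + 1) := by
    intro t ht
    have h := hadm 2 (t + 1) le_rfl (by omega) ![t, 2]
      (by simp [Fin.forall_fin_succ]; omega) (by simp [Fin.forall_fin_succ, ht]) (by simp)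
    simpa using h
  have ge_two : ∀ t, 2 ≤ t → 3 * (t - 1) ≤ f t := by
    intro t ht
    induction t, ht using Nat.le_induction with
    | base => exact two
    | succ t ht ih =>
      have := step t ht
      omega
  intro t ht
  unfold filtrationFunction
  split_ifs with h
  · exact hfpos t ht
  · exact ge_two t (by omega)
end

section
/- Let l be a prime and let ℤ_(l) denote the localization of ℤ at the prime ideal (l). Let V* and W* be cochain complexes of ℤ_(l)-modules, graded over the natural numbers, such that each V^i and each W^i is a torsion-free ℤ_(l)-module and each cohomology module H^i(V*) and H^i(W*) is a finitely generated ℤ_(l)-module. Let f : V* → W* be a map of cochain complexes and let t ≥ 1. If the induced map f ⊗ id : V* ⊗_{ℤ_(l)} 𝔽_l → W* ⊗_{ℤ_(l)} 𝔽_l is a t-equivalence, then f itself is a t-equivalence. -/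
open CategoryTheory

namespace HomologicalComplex

section Elements

universe v u

variable {R : Type u} [Ring R] {ι : Type*} {c : ComplexShape ι}
  (K : HomologicalComplex (ModuleCat.{v} R) c)

lemma homologyπ_surjective (i : ι) : Function.Surjective (K.homologyπ i) :=
  (ModuleCat.epi_iff_surjective _).1 inferInstance

lemma iCycles_injective (i : ι) : Function.Injective (K.iCycles i) :=
  (ModuleCat.mono_iff_injective _).1 inferInstance

lemma d_iCycles_apply (i j : ι) (z : K.cycles i) : K.d i j (K.iCycles i z) = 0 := by
  rw [← ConcreteCategory.comp_apply, K.iCycles_d]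
  rfl

lemma d_d_apply (i j k : ι) (x : K.X i) : K.d j k (K.d i j x) = 0 := by
  rw [← ConcreteCategory.comp_apply, K.d_comp_d]
  rfl

lemma Hom.comm_apply {K L : HomologicalComplex (ModuleCat.{v} R) c} (f : K ⟶ L) (i j : ι)
    (x : K.X i) : L.d i j (f.f i x) = f.f j (K.d i j x) := by
  rw [← ConcreteCategory.comp_apply, f.comm]
  rfl

lemma exists_iCycles_eq {i j : ι} (hj : c.next i = j) (x : K.X i) (hx : K.d i j x = 0) :
    ∃ z : K.cycles i, K.iCycles i z = x := by
  subst hj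
  refine ⟨(K.sc i).moduleCatCyclesIso.inv ⟨x, hx⟩, ?_⟩
  exact ConcreteCategory.congr_hom (K.sc i).moduleCatCyclesIso_inv_iCycles ⟨x, hx⟩

lemma homologyπ_eq_zero_iff {i j : ι} (hi : c.prev j = i) (z : K.cycles j) :
    K.homologyπ j z = 0 ↔ ∃ y : K.X i, K.d i j y = K.iCycles j z := by
  have hex : (ShortComplex.mk _ _ (K.toCycles_comp_homologyπ i j)).Exact :=
    ShortComplex.exact_of_g_is_cokernel _ (K.homologyIsCokernel i j hi)
  have hto (y : K.X i) : K.iCycles j (K.toCycles i j y) = K.d i j y := by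
    rw [← ConcreteCategory.comp_apply, K.toCycles_i]
  constructor
  · intro hz
    obtain ⟨y, hy⟩ := (ShortComplex.moduleCat_exact_iff _).1 hex z hz
    refine ⟨y, ?_⟩
    rw [← hto]
    exact congrArg _ hy
  · rintro ⟨y, hy⟩
    obtain rfl : K.toCycles i j y = z := K.iCycles_injective j ((hto y).trans hy)
    rw [← ConcreteCategory.comp_apply, K.toCycles_comp_homologyπ]
    rfl

variable {K} {L : HomologicalComplex (ModuleCat.{v} R) c} (f : K ⟶ L)

lemma homologyMap_homologyπ_apply (i : ι) (z : K.cycles i) :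
    homologyMap f i (K.homologyπ i z) = L.homologyπ i (cyclesMap f i z) := by
  rw [← ConcreteCategory.comp_apply, homologyπ_naturality]
  rfl

lemma iCycles_cyclesMap_apply (i : ι) (z : K.cycles i) :
    L.iCycles i (cyclesMap f i z) = f.f i (K.iCycles i z) := by
  rw [← ConcreteCategory.comp_apply, cyclesMap_i]
  rfl

lemma mono_homologyMap_iff_elements {i j k : ι} (hi : c.prev j = i) (hk : c.next j = k) :
    Mono (homologyMap f j) ↔ ∀ x : K.X j, K.d j k x = 0 →
      (∃ y, L.d i j y = f.f j x) → ∃ x', K.d i j x' = x := by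
  rw [ModuleCat.mono_iff_injective, injective_iff_map_eq_zero]
  constructor
  · rintro h x hx hy
    obtain ⟨z, rfl⟩ := K.exists_iCycles_eq hk x hx
    rw [← K.homologyπ_eq_zero_iff hi]
    apply h
    rwa [homologyMap_homologyπ_apply, L.homologyπ_eq_zero_iff hi, iCycles_cyclesMap_apply]
  · intro h a ha
    obtain ⟨z, rfl⟩ := K.homologyπ_surjective j a
    rw [homologyMap_homologyπ_apply, L.homologyπ_eq_zero_iff hi, iCycles_cyclesMap_apply] at ha
    exact (K.homologyπ_eq_zero_iff hi z).2 (h _ (K.d_iCycles_apply j k z) ha)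

lemma epi_homologyMap_iff_elements {i j k : ι} (hi : c.prev j = i) (hk : c.next j = k) :
    Epi (homologyMap f j) ↔ ∀ y : L.X j, L.d j k y = 0 →
      ∃ x y', K.d j k x = 0 ∧ y = f.f j x + L.d i j y' := by
  rw [ModuleCat.epi_iff_surjective]
  constructor
  · intro h y hy
    obtain ⟨z, rfl⟩ := L.exists_iCycles_eq hk y hy
    obtain ⟨a, ha⟩ := h (L.homologyπ j z)
    obtain ⟨x, rfl⟩ := K.homologyπ_surjective j a
    rw [homologyMap_homologyπ_apply, eq_comm, ← sub_eq_zero, ← map_sub,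
      L.homologyπ_eq_zero_iff hi] at ha
    obtain ⟨y', hy'⟩ := ha
    refine ⟨K.iCycles j x, y', K.d_iCycles_apply j k x, ?_⟩
    rw [hy', map_sub, iCycles_cyclesMap_apply]
    abel
  · intro h b
    obtain ⟨z, rfl⟩ := L.homologyπ_surjective j b
    obtain ⟨x, y', hx, hy⟩ := h _ (L.d_iCycles_apply j k z)
    obtain ⟨w, rfl⟩ := K.exists_iCycles_eq hk x hx
    refine ⟨K.homologyπ j w, ?_⟩
    rw [homologyMap_homologyπ_apply, eq_comm, ← sub_eq_zero, ← map_sub,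
      L.homologyπ_eq_zero_iff hi]
    refine ⟨y', ?_⟩
    rw [map_sub, iCycles_cyclesMap_apply, hy]
    abel

end Elements

section Nakayama

universe v u

variable {R : Type u} [CommRing R] [IsLocalRing R] {ι : Type*}
  {c : ComplexShape ι} {K L : HomologicalComplex (ModuleCat.{v} R) c} (f : K ⟶ L) {ϖ : R}

lemma mono_homologyMap_of_forall_exists_smul [IsNoetherianRing R]
    (hϖ : ϖ ∈ IsLocalRing.maximalIdeal R)
    {i j k : ι} (hi : c.prev j = i) (hk : c.next j = k) [Module.Finite R (K.homology j)]
    (h : ∀ x : K.X j, K.d j k x = 0 → (∃ y, L.d i j y = f.f j x) →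
      ∃ x₁ x', K.d j k x₁ = 0 ∧ (∃ y, L.d i j y = f.f j x₁) ∧ x = ϖ • x₁ + K.d i j x') :
    Mono (homologyMap f j) := by
  rw [ModuleCat.mono_iff_injective]
  change Function.Injective (homologyMap f j).hom
  rw [← LinearMap.ker_eq_bot]
  refine Submodule.eq_bot_of_le_smul_of_le_jacobson_bot (IsLocalRing.maximalIdeal R) _
    (IsNoetherian.noetherian _) ?_ (IsLocalRing.jacobson_eq_maximalIdeal ⊥ bot_ne_top).ge
  intro a ha
  have hker (z : K.cycles j) : homologyMap f j (K.homologyπ j z) = 0 ↔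
      ∃ y, L.d i j y = f.f j (K.iCycles j z) := by
    rw [homologyMap_homologyπ_apply, L.homologyπ_eq_zero_iff hi, iCycles_cyclesMap_apply]
  obtain ⟨z, rfl⟩ := K.homologyπ_surjective j a
  obtain ⟨x₁, x', hx₁, hy, hx⟩ := h _ (K.d_iCycles_apply j k z) ((hker z).1 ha)
  obtain ⟨z₁, rfl⟩ := K.exists_iCycles_eq hk x₁ hx₁
  have hz : K.homologyπ j z = ϖ • K.homologyπ j z₁ := by
    rw [← sub_eq_zero, ← map_smul, ← map_sub, K.homologyπ_eq_zero_iff hi]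
    refine ⟨x', ?_⟩
    rw [map_sub, map_smul, hx]
    abel
  rw [hz]
  exact Submodule.smul_mem_smul hϖ ((hker z₁).2 hy)

lemma epi_homologyMap_of_forall_exists_smul (hϖ : ϖ ∈ IsLocalRing.maximalIdeal R)
    {i j k : ι} (hi : c.prev j = i) (hk : c.next j = k) [Module.Finite R (L.homology j)]
    (h : ∀ y : L.X j, L.d j k y = 0 →
      ∃ x y₁ y', K.d j k x = 0 ∧ L.d j k y₁ = 0 ∧ y = f.f j x + ϖ • y₁ + L.d i j y') :
    Epi (homologyMap f j) := by
  rw [ModuleCat.epi_iff_surjective]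
  change Function.Surjective (homologyMap f j).hom
  rw [← LinearMap.range_eq_top, ← top_le_iff]
  refine Submodule.le_of_le_smul_of_le_jacobson_bot (I := IsLocalRing.maximalIdeal R)
    Module.Finite.fg_top (IsLocalRing.jacobson_eq_maximalIdeal ⊥ bot_ne_top).ge ?_
  intro b _
  obtain ⟨z, rfl⟩ := L.homologyπ_surjective j b
  obtain ⟨x, y₁, y', hx, hy₁, hy⟩ := h _ (L.d_iCycles_apply j k z)
  obtain ⟨w, rfl⟩ := K.exists_iCycles_eq hk x hx
  obtain ⟨z₁, rfl⟩ := L.exists_iCycles_eq hk y₁ hy₁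
  have hz : L.homologyπ j z = homologyMap f j (K.homologyπ j w) + ϖ • L.homologyπ j z₁ := by
    rw [homologyMap_homologyπ_apply, ← sub_eq_zero, ← map_smul, ← map_add, ← map_sub,
      L.homologyπ_eq_zero_iff hi]
    refine ⟨y', ?_⟩
    rw [map_sub, map_add, map_smul, iCycles_cyclesMap_apply, hy]
    abel
  rw [hz]
  exact Submodule.add_mem_sup ⟨_, rfl⟩ (Submodule.smul_mem_smul hϖ Submodule.mem_top)

end Nakayama

section ResidueField

universe u

open TensorProduct

variable {R : Type u} [CommRing R] [IsLocalRing R]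

lemma _root_.IsLocalRing.tmul_one_residueField_eq_zero_iff {ϖ : R}
    (hϖ : IsLocalRing.maximalIdeal R = Ideal.span {ϖ}) {M : Type*} [AddCommGroup M] [Module R M]
    (m : M) : m ⊗ₜ[R] (1 : IsLocalRing.ResidueField R) = 0 ↔ ∃ m', m = ϖ • m' := by
  have h : TensorProduct.tensorQuotEquivQuotSMul M (IsLocalRing.maximalIdeal R)
      (m ⊗ₜ[R] Ideal.Quotient.mk (IsLocalRing.maximalIdeal R) 1) = Submodule.Quotient.mk m := by
    rw [TensorProduct.tensorQuotEquivQuotSMul_tmul_mk, one_smul]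
  refine (LinearEquiv.map_eq_zero_iff
    (TensorProduct.tensorQuotEquivQuotSMul M (IsLocalRing.maximalIdeal R))).symm.trans ?_
  change TensorProduct.tensorQuotEquivQuotSMul M (IsLocalRing.maximalIdeal R)
      (m ⊗ₜ[R] Ideal.Quotient.mk (IsLocalRing.maximalIdeal R) 1) = 0 ↔ _
  rw [h, Submodule.Quotient.mk_eq_zero, hϖ, Submodule.ideal_span_singleton_smul,
    Submodule.mem_smul_pointwise_iff_exists]
  simp [eq_comm]

lemma _root_.IsLocalRing.exists_tmul_one_residueField_eq {M : Type*} [AddCommGroup M] [Module R M]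
    (x : M ⊗[R] IsLocalRing.ResidueField R) :
    ∃ m : M, m ⊗ₜ[R] (1 : IsLocalRing.ResidueField R) = x := by
  induction x with
  | zero => exact ⟨0, zero_tmul _ _⟩
  | tmul m a =>
    obtain ⟨r, rfl⟩ := IsLocalRing.residue_surjective a
    refine ⟨r • m, ?_⟩
    rw [smul_tmul, ← IsLocalRing.ResidueField.algebraMap_eq, Algebra.algebraMap_eq_smul_one]
  | add x y hx hy =>
    obtain ⟨m, rfl⟩ := hx
    obtain ⟨n, rfl⟩ := hy
    exact ⟨m + n, add_tmul _ _ _⟩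

variable {ι : Type*} {c : ComplexShape ι} {K L : HomologicalComplex (ModuleCat.{u} R) c}

variable (c) in
/-- The functor `- ⊗ κ` on complexes of modules over a local ring with residue field `κ`. -/
noncomputable abbrev tensorResidueField :
    HomologicalComplex (ModuleCat.{u} R) c ⥤ HomologicalComplex (ModuleCat.{u} R) c :=
  (MonoidalCategory.tensorRight
    (ModuleCat.of R (IsLocalRing.ResidueField R))).mapHomologicalComplex c

/-- The reduction `m ⊗ 1` of an element `m` of `K.X i` in the residue complex. -/
noncomputable def reduction (K : HomologicalComplex (ModuleCat.{u} R) c) (i : ι) :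
    K.X i →ₗ[R] ((tensorResidueField c).obj K).X i :=
  (TensorProduct.mk R (K.X i) (IsLocalRing.ResidueField R)).flip 1

lemma reduction_surjective (i : ι) : Function.Surjective (K.reduction i) :=
  IsLocalRing.exists_tmul_one_residueField_eq

lemma reduction_eq_zero_iff {ϖ : R} (hϖ : IsLocalRing.maximalIdeal R = Ideal.span {ϖ}) {i : ι}
    (m : K.X i) : K.reduction i m = 0 ↔ ∃ m', m = ϖ • m' :=
  IsLocalRing.tmul_one_residueField_eq_zero_iff hϖ m

lemma reduction_d (i j : ι) (m : K.X i) :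
    ((tensorResidueField c).obj K).d i j (K.reduction i m) = K.reduction j (K.d i j m) :=
  rfl

lemma reduction_f (f : K ⟶ L) (i : ι) (m : K.X i) :
    ((tensorResidueField c).map f).f i (K.reduction i m) = L.reduction i (f.f i m) :=
  rfl

lemma reduction_eq_iff {ϖ : R} (hϖ : IsLocalRing.maximalIdeal R = Ideal.span {ϖ}) {i : ι}
    (m n : K.X i) : K.reduction i m = K.reduction i n ↔ ∃ m', m = n + ϖ • m' := by
  rw [← sub_eq_zero, ← map_sub, reduction_eq_zero_iff hϖ]
  simp only [sub_eq_iff_eq_add']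

variable {f : K ⟶ L} {ϖ : R}

lemma exists_eq_d_add_smul_of_mono
    (hϖ : IsLocalRing.maximalIdeal R = Ideal.span {ϖ}) {i j k : ι} (hi : c.prev j = i) (hk : c.next j = k)
    (h : Mono (homologyMap ((tensorResidueField c).map f) j)) {x : K.X j} {x₁ : K.X k}
    (hx : K.d j k x = ϖ • x₁) {y : L.X i} {y₁ : L.X j} (hy : f.f j x = L.d i j y + ϖ • y₁) :
    ∃ x' x₂, x = K.d i j x' + ϖ • x₂ := by
  obtain ⟨x', hx'⟩ := (mono_homologyMap_iff_elements _ hi hk).1 h (K.reduction j x)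
    (by rw [reduction_d, reduction_eq_zero_iff hϖ]; exact ⟨_, hx⟩)
    ⟨L.reduction i y, by
      rw [reduction_d, reduction_f, eq_comm, reduction_eq_iff hϖ]; exact ⟨_, hy⟩⟩
  obtain ⟨x', rfl⟩ := reduction_surjective i x'
  rw [reduction_d, eq_comm, reduction_eq_iff hϖ] at hx'
  exact ⟨x', hx'⟩

lemma exists_eq_add_d_add_smul_of_epi
    (hϖ : IsLocalRing.maximalIdeal R = Ideal.span {ϖ}) {i j k : ι} (hi : c.prev j = i) (hk : c.next j = k)
    (h : Epi (homologyMap ((tensorResidueField c).map f) j)) {y : L.X j} {y₁ : L.X k}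
    (hy : L.d j k y = ϖ • y₁) :
    ∃ x x₁ y' y₂, K.d j k x = ϖ • x₁ ∧ y = f.f j x + L.d i j y' + ϖ • y₂ := by
  obtain ⟨x, y', hx, hy'⟩ := (epi_homologyMap_iff_elements _ hi hk).1 h (L.reduction j y)
    (by rw [reduction_d, reduction_eq_zero_iff hϖ]; exact ⟨_, hy⟩)
  obtain ⟨x, rfl⟩ := reduction_surjective j x
  obtain ⟨y', rfl⟩ := reduction_surjective i y'
  rw [reduction_d, reduction_eq_zero_iff hϖ] at hx
  rw [reduction_d, reduction_f, ← map_add, reduction_eq_iff hϖ] at hy'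
  obtain ⟨x₁, hx₁⟩ := hx
  obtain ⟨y₂, hy₂⟩ := hy'
  exact ⟨x, x₁, y', y₂, hx₁, hy₂⟩

end ResidueField

section PrincipalMaximalIdeal

universe u

variable {R : Type u} [CommRing R] [IsLocalRing R]
  {K L : CochainComplex (ModuleCat.{u} R) ℕ} {f : K ⟶ L} {ϖ : R}

lemma mono_homologyMap_zero_of_residueField [IsNoetherianRing R]
    (hϖ : IsLocalRing.maximalIdeal R = Ideal.span {ϖ})
    (hK : ∀ i, IsSMulRegular (K.X i) ϖ) (hL : ∀ i, IsSMulRegular (L.X i) ϖ)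
    [Module.Finite R (K.homology 0)]
    (h : Mono (homologyMap ((tensorResidueField (.up ℕ)).map f) 0)) :
    Mono (homologyMap f 0) := by
  have hp : (ComplexShape.up ℕ).prev 0 = 0 := CochainComplex.prev_nat_zero
  have hn : (ComplexShape.up ℕ).next 0 = 1 := CochainComplex.next ℕ 0
  have hK0 (x : K.X 0) : K.d 0 0 x = 0 := by rw [K.shape 0 0 (by simp)]; rfl
  have hL0 (x : L.X 0) : L.d 0 0 x = 0 := by rw [L.shape 0 0 (by simp)]; rfl
  refine mono_homologyMap_of_forall_exists_smul f
    (hϖ ▸ Ideal.mem_span_singleton_self ϖ) hp hn ?_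
  rintro x hx ⟨y, hy⟩
  obtain ⟨x', x₂, rfl⟩ := exists_eq_d_add_smul_of_mono hϖ hp hn h (x := x) (x₁ := 0) (y := y)
    (y₁ := 0) (by simpa using hx) (by rw [hy, smul_zero, add_zero])
  simp only [hK0, hL0, zero_add, map_smul] at hx hy ⊢
  exact ⟨x₂, 0, (hK 1).right_eq_zero_of_smul hx,
    ⟨0, ((hL 0).right_eq_zero_of_smul hy.symm).symm⟩, by simp⟩

lemma mono_homologyMap_succ_of_residueField [IsNoetherianRing R]
    (hϖ : IsLocalRing.maximalIdeal R = Ideal.span {ϖ})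
    (hK : ∀ i, IsSMulRegular (K.X i) ϖ) (hL : ∀ i, IsSMulRegular (L.X i) ϖ)
    (i : ℕ) [Module.Finite R (K.homology (i + 1))]
    (he : Epi (homologyMap ((tensorResidueField (.up ℕ)).map f) i))
    (hm : Mono (homologyMap ((tensorResidueField (.up ℕ)).map f) (i + 1))) :
    Mono (homologyMap f (i + 1)) := by
  have hp : (ComplexShape.up ℕ).prev (i + 1) = i := CochainComplex.prev_nat_succ i
  have hn : (ComplexShape.up ℕ).next (i + 1) = i + 1 + 1 := CochainComplex.next ℕ _
  refine mono_homologyMap_of_forall_exists_smul f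
    (hϖ ▸ Ideal.mem_span_singleton_self ϖ) hp hn ?_
  rintro x hx ⟨y, hy⟩
  obtain ⟨x', x₂, rfl⟩ := exists_eq_d_add_smul_of_mono hϖ hp hn hm (x := x) (x₁ := 0) (y := y)
    (y₁ := 0) (by simpa using hx) (by simp [hy])
  have hdx₂ : K.d (i + 1) (i + 1 + 1) x₂ = 0 :=
    (hK _).right_eq_zero_of_smul (by rwa [map_add, d_d_apply, zero_add, map_smul] at hx)
  have hdy : L.d i (i + 1) (y - f.f i x') = ϖ • f.f (i + 1) x₂ := by
    rw [map_sub, Hom.comm_apply, hy]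
    simp
  obtain ⟨u, z, y', w, hu, hw⟩ := exists_eq_add_d_add_smul_of_epi hϖ rfl
    (CochainComplex.next ℕ i) he hdy
  have hdz : K.d (i + 1) (i + 1 + 1) z = 0 := by
    refine (hK _).right_eq_zero_of_smul ?_
    rw [← map_smul, ← hu, d_d_apply]
  refine ⟨x₂ - z, x' + u, by simp [hdx₂, hdz], ⟨w, hL _ ?_⟩, ?_⟩
  · have h := congrArg (L.d i (i + 1)) hw
    rw [hdy, map_add, map_add, d_d_apply, Hom.comm_apply, hu] at h
    simp only [map_smul, map_sub, smul_sub, add_zero] at h ⊢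
    rw [h]
    abel
  · rw [map_add, hu, smul_sub]
    abel

lemma epi_homologyMap_of_residueField
    (hϖ : IsLocalRing.maximalIdeal R = Ideal.span {ϖ})
    (hK : ∀ i, IsSMulRegular (K.X i) ϖ) (hL : ∀ i, IsSMulRegular (L.X i) ϖ)
    (i : ℕ) [Module.Finite R (L.homology i)]
    (he : Epi (homologyMap ((tensorResidueField (.up ℕ)).map f) i))
    (hm : Mono (homologyMap f (i + 1))) :
    Epi (homologyMap f i) := by
  have hn : (ComplexShape.up ℕ).next i = i + 1 := CochainComplex.next ℕ _
  refine epi_homologyMap_of_forall_exists_smul f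
    (hϖ ▸ Ideal.mem_span_singleton_self ϖ) rfl hn ?_
  intro w hw
  obtain ⟨u, z, y', y, hu, rfl⟩ := exists_eq_add_d_add_smul_of_epi hϖ rfl hn he (y := w)
    (y₁ := 0) (by simpa using hw)
  have hdz : K.d (i + 1) (i + 1 + 1) z = 0 := by
    refine (hK _).right_eq_zero_of_smul ?_
    rw [← map_smul, ← hu, d_d_apply]
  have hfz : f.f (i + 1) z + L.d i (i + 1) y = 0 := by
    refine (hL _).right_eq_zero_of_smul ?_
    rw [map_add, map_add, d_d_apply, Hom.comm_apply, hu] at hw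
    simpa using hw
  obtain ⟨z', rfl⟩ := (mono_homologyMap_iff_elements f (CochainComplex.prev_nat_succ i)
    (CochainComplex.next ℕ (i + 1))).1 hm z hdz
      ⟨-y, by rw [map_neg, eq_neg_of_add_eq_zero_left hfz]⟩
  refine ⟨u - ϖ • z', y + f.f i z', y', by rw [map_sub, hu, map_smul, sub_self], ?_, ?_⟩
  · rw [map_add, Hom.comm_apply, add_comm (L.d _ _ y), hfz]
  · simp only [map_sub, map_smul, smul_add]
    abel

end PrincipalMaximalIdeal

end HomologicalComplex

/-- Lemma 4.2: over `ℤ_(l)`, a cochain map between degreewise torsion-free complexes with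
degreewise finitely generated cohomology which becomes a `t`-equivalence after tensoring
with the residue field `𝔽_l` is itself a `t`-equivalence. -/
theorem t_equivalence_of_mod_l_t_equivalence
    (l : ℕ) (hl : l.Prime) [hI : (Ideal.span {(l : ℤ)}).IsPrime]
    (V W : CochainComplex (ModuleCat (Localization.AtPrime (Ideal.span {(l : ℤ)}))) ℕ)
    (hVtf : ∀ i, NoZeroSMulDivisors (Localization.AtPrime (Ideal.span {(l : ℤ)})) (V.X i))
    (hWtf : ∀ i, NoZeroSMulDivisors (Localization.AtPrime (Ideal.span {(l : ℤ)})) (W.X i))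
    (hVfg : ∀ i, Module.Finite (Localization.AtPrime (Ideal.span {(l : ℤ)})) (V.homology i))
    (hWfg : ∀ i, Module.Finite (Localization.AtPrime (Ideal.span {(l : ℤ)})) (W.homology i))
    (f : V ⟶ W) (t : ℕ) (ht : 1 ≤ t)
    (hmod :
      (∀ i ≤ t, IsIso (HomologicalComplex.homologyMap
        ((CategoryTheory.MonoidalCategory.tensorRight
            (ModuleCat.of (Localization.AtPrime (Ideal.span {(l : ℤ)}))
              (IsLocalRing.ResidueField
                (Localization.AtPrime (Ideal.span {(l : ℤ)}))))).mapHomologicalComplex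
            (ComplexShape.up ℕ) |>.map f) i)) ∧
      Mono (HomologicalComplex.homologyMap
        ((CategoryTheory.MonoidalCategory.tensorRight
            (ModuleCat.of (Localization.AtPrime (Ideal.span {(l : ℤ)}))
              (IsLocalRing.ResidueField
                (Localization.AtPrime (Ideal.span {(l : ℤ)}))))).mapHomologicalComplex
            (ComplexShape.up ℕ) |>.map f) (t + 1))) :
    (∀ i ≤ t, IsIso (HomologicalComplex.homologyMap f i)) ∧
      Mono (HomologicalComplex.homologyMap f (t + 1)) := by
  have := hVfg
  have := hWfg
  have hϖ : IsLocalRing.maximalIdeal (Localization.AtPrime (Ideal.span {(l : ℤ)})) =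
      Ideal.span {algebraMap ℤ (Localization.AtPrime (Ideal.span {(l : ℤ)})) l} := by
    rw [← Localization.AtPrime.map_eq_maximalIdeal, Ideal.map_span, Set.image_singleton]
  have : IsNoetherianRing (Localization.AtPrime (Ideal.span {(l : ℤ)})) :=
    IsLocalization.isNoetherianRing (Ideal.span {(l : ℤ)}).primeCompl _ inferInstance
  have hl0 : algebraMap ℤ (Localization.AtPrime (Ideal.span {(l : ℤ)})) l ≠ 0 := by
    rw [Ne, FaithfulSMul.algebraMap_eq_zero_iff]
    exact_mod_cast hl.ne_zero
  have hV i : IsSMulRegular (V.X i)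
      (algebraMap ℤ (Localization.AtPrime (Ideal.span {(l : ℤ)})) l) :=
    have := hVtf i
    smul_right_injective _ hl0
  have hW i : IsSMulRegular (W.X i)
      (algebraMap ℤ (Localization.AtPrime (Ideal.span {(l : ℤ)})) l) :=
    have := hWtf i
    smul_right_injective _ hl0
  have hmono : ∀ i ≤ t + 1, Mono (HomologicalComplex.homologyMap f i) := by
    intro i hi
    cases i with
    | zero =>
      have := hmod.1 0 (Nat.zero_le t)
      exact HomologicalComplex.mono_homologyMap_zero_of_residueField hϖ hV hW inferInstance
    | succ i =>
      have := hmod.1 i (by omega)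
      refine HomologicalComplex.mono_homologyMap_succ_of_residueField hϖ hV hW i inferInstance ?_
      rcases hi.lt_or_eq with hi | hi
      · have := hmod.1 (i + 1) (by omega)
        infer_instance
      · obtain rfl : i = t := by omega
        exact hmod.2
  refine ⟨fun i hi => ?_, hmono _ le_rfl⟩
  have := hmod.1 i hi
  have := hmono i (by omega)
  have := HomologicalComplex.epi_homologyMap_of_residueField hϖ hV hW i inferInstance
    (hmono (i + 1) (by omega))
  exact isIso_of_mono_of_epi _
end
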